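/- For A = ℤ[C₅], the integral group algebra of the cyclic group of order 5, the first homology of the partial complex vanishes: ker ∂₁ = im ∂₂; that is, HS₁(ℤ[C₅]) = 0. -/

import Mathlib

open TensorProduct

set_option synthInstance.maxHeartbeats 1000000
set_option maxHeartbeats 1000000

/-- The algebra `A = ℤ[C5]`, the integral group algebra of the cyclic group
of order 5. -/
abbrev A : Type := MonoidAlgebra ℤ (Multiplicative (ZMod 5))

/-- An additive map out of `ZMod p` killing a nonzero element is zero. -/
theorem ZMod.addMonoidHom_eq_zero_of_apply_eq_zero {p : ℕ} [Fact p.Prime] {M : Type*}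
    [AddCommGroup M] (φ : ZMod p →+ M) {s : ZMod p} (hs : s ≠ 0) (h : φ s = 0) (y : ZMod p) :
    φ y = 0 := by
  have hy : y = (y * s⁻¹).val • s := by
    rw [nsmul_eq_mul, ZMod.natCast_zmod_val, inv_mul_cancel_right₀ hs]
  rw [hy, map_nsmul, h, nsmul_zero]

section Relations

variable {p : ℕ} {M : Type*} [AddCommGroup M] {F : ZMod p → ZMod p → ZMod p → M}

/-- The relations imposed on the group basis of `ℤ[Cₚ]^{⊗3}` by the image of `∂₂`. -/
structure IsHSRelator (F : ZMod p → ZMod p → ZMod p → M) : Prop where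
  rel : ∀ a b c d, F (a + b) c d + F d (c + a) b + F (b + c + a) 0 d + F d (b + c) a = 0
  unit : ∀ a, F 0 a 0 = 0

namespace IsHSRelator

theorem apply_zero_add (h : IsHSRelator F) (z s : ZMod p) : F s 0 z + F z s 0 = 0 := by
  have h₁ := h.rel 0 z s 0
  have h₂ := h.rel 0 0 (z + s) 0
  have h₃ := h.rel 0 0 s z
  simp only [zero_add, add_zero, h.unit] at h₁ h₂ h₃
  grind

theorem swap_outer (h : IsHSRelator F) (x y z : ZMod p) : F x y z = -F z y x := by
  have h₁ := h.rel 0 x y z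
  have h₂ := h.apply_zero_add z (x + y)
  simp only [zero_add, add_zero] at h₁
  grind

/-- The additive map measuring how far `F d y (t - d - y)` is from being independent of `y`. -/
def defect (h : IsHSRelator F) (t d : ZMod p) : ZMod p →+ M :=
  AddMonoidHom.mk' (fun y ↦ F d y (t - d - y) - F d (t - d) 0) fun a c ↦ by
    have h₁ := h.rel a (t - d - a - c) c d
    have h₂ := h.rel a (t - d - a) 0 d
    have h₃ := h.apply_zero_add d (t - d)
    have h₄ := h.swap_outer (t - d - c) c d
    have e₁ : a + (t - d - a - c) = t - d - c := by ring
    have e₂ : t - d - a - c + c + a = t - d := by ring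
    have e₃ : t - d - a - c + c = t - d - a := by ring
    have e₄ : a + (t - d - a) = t - d := by ring
    have e₅ : t - d - a + 0 + a = t - d := by ring
    have e₆ : t - d - (a + c) = t - d - a - c := by ring
    rw [e₁, e₂, e₃, add_comm c a] at h₁
    rw [e₄, e₅, zero_add, add_zero] at h₂
    rw [e₆]
    grind

theorem defect_apply (h : IsHSRelator F) (t d y : ZMod p) :
    h.defect t d y = F d y (t - d - y) - F d (t - d) 0 := rfl

theorem defect_self (h : IsHSRelator F) (t d : ZMod p) : h.defect t d (t - d) = 0 := by
  simp [defect_apply]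

variable [Fact p.Prime]

theorem apply_eq (h : IsHSRelator F) {t d : ZMod p} (hd : d ≠ t) (y : ZMod p) :
    F d y (t - d - y) = F d (t - d) 0 :=
  sub_eq_zero.mp <| ZMod.addMonoidHom_eq_zero_of_apply_eq_zero (h.defect t d)
    (sub_ne_zero.mpr hd.symm) (h.defect_self t d) y

theorem apply_add_apply (h : IsHSRelator F) {t x z : ZMod p} (hx : x ≠ t) (hz : z ≠ t) :
    F x (t - x) 0 + F z (t - z) 0 = 0 := by
  have h₁ := h.swap_outer x (t - x - z) z
  have h₂ := h.apply_eq hx (t - x - z)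
  have h₃ := h.apply_eq hz (t - x - z)
  rw [show t - x - (t - x - z) = z by ring] at h₂
  rw [show t - z - (t - x - z) = x by ring] at h₃
  rw [← h₂, ← h₃, h₁, neg_add_cancel]

theorem apply_sub_zero (h : IsHSRelator F) {t : ZMod p} (ht : t ≠ 0) (x : ZMod p) :
    F x (t - x) 0 = 0 := by
  rcases eq_or_ne x t with rfl | hx
  · simpa [h.unit] using h.apply_zero_add 0 x
  · simpa [h.unit] using h.apply_add_apply hx ht.symm

theorem apply_eq_zero_of_ne (h : IsHSRelator F) (hp : p ≠ 2) {t : ZMod p} (ht : t ≠ 0)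
    (x y : ZMod p) : F x y (t - x - y) = 0 := by
  rcases eq_or_ne x t with rfl | hx
  · have hneg : -x ≠ x :=
      (ZMod.ne_neg_self ((Fact.out : p.Prime).odd_of_ne_two hp) ht).symm
    have h₁ : h.defect x x x = 0 := by
      have h₂ := h.apply_eq hneg x
      rw [show x - -x - x = x by ring, h.apply_sub_zero ht] at h₂
      rw [defect_apply, h.apply_sub_zero ht, sub_zero, sub_self, zero_sub, h.swap_outer, h₂,
        neg_zero]
    have h₃ := ZMod.addMonoidHom_eq_zero_of_apply_eq_zero _ ht h₁ y
    rwa [defect_apply, h.apply_sub_zero ht, sub_zero] at h₃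
  · rw [h.apply_eq hx, h.apply_sub_zero ht]

theorem apply_neg_zero (h : IsHSRelator F) (hp : p ≠ 2) (x : ZMod p) : F x (-x) 0 = 0 := by
  rcases eq_or_ne x 0 with rfl | hx
  · exact h.unit _
  have h₁ : h.defect 0 0 (-x) = -F x (-x) 0 := by
    simp [defect_apply, h.unit, h.swap_outer 0 (-x) x]
  have h₂ : 2 • F x (-x) 0 = 0 := by
    simpa [two_nsmul] using h.apply_add_apply hx hx
  have h₃ : p • F x (-x) 0 = 0 := by
    rw [← neg_eq_zero, ← smul_neg, ← h₁, ← map_nsmul]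
    simp
  have hcop : Nat.Coprime 2 p :=
    (Nat.coprime_primes Nat.prime_two Fact.out).mpr hp.symm
  have := Nat.dvd_gcd (addOrderOf_dvd_of_nsmul_eq_zero h₂) (addOrderOf_dvd_of_nsmul_eq_zero h₃)
  rwa [hcop.gcd_eq_one, Nat.dvd_one, AddMonoid.addOrderOf_eq_one_iff] at this

theorem apply_eq_zero (h : IsHSRelator F) (hp : p ≠ 2) (x y z : ZMod p) : F x y z = 0 := by
  obtain ⟨t, rfl⟩ : ∃ t, z = t - x - y := ⟨x + y + z, by ring⟩
  rcases eq_or_ne t 0 with rfl | ht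
  · rcases eq_or_ne x 0 with rfl | hx
    · rw [h.swap_outer]
      rcases eq_or_ne y 0 with rfl | hy
      · simp [h.unit]
      · simpa using h.apply_neg_zero hp (-y)
    · rw [h.apply_eq hx, zero_sub, h.apply_neg_zero hp]
  · exact h.apply_eq_zero_of_ne hp ht x y

end IsHSRelator

end Relations

/-- HS₁(ℤ[C₅]) = 0: the first homology of the partial complex vanishes, i.e. `ker ∂₁ = im ∂₂`. -/
theorem HS1_int_C5
    (d₁ : A ⊗[ℤ] (A ⊗[ℤ] A) →ₗ[ℤ] A)
    (d₂ : ((A ⊗[ℤ] (A ⊗[ℤ] (A ⊗[ℤ] A))) × A) →ₗ[ℤ] A ⊗[ℤ] (A ⊗[ℤ] A))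
    (h₁ : ∀ a b c : A, d₁ (a ⊗ₜ[ℤ] (b ⊗ₜ[ℤ] c)) = a * b * c - c * b * a)
    (h₂ : ∀ a b c d : A, d₂ (a ⊗ₜ[ℤ] (b ⊗ₜ[ℤ] (c ⊗ₜ[ℤ] d)), 0) =
      (a * b) ⊗ₜ[ℤ] (c ⊗ₜ[ℤ] d) + d ⊗ₜ[ℤ] ((c * a) ⊗ₜ[ℤ] b) +
        (b * c * a) ⊗ₜ[ℤ] ((1 : A) ⊗ₜ[ℤ] d) + d ⊗ₜ[ℤ] ((b * c) ⊗ₜ[ℤ] a))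
    (h₃ : ∀ a : A, d₂ (0, a) = (1 : A) ⊗ₜ[ℤ] (a ⊗ₜ[ℤ] (1 : A))) :
    LinearMap.ker d₁ = LinearMap.range d₂ := by
  have hker : d₁ = 0 := by
    ext a b c : 8
    refine (h₁ _ _ _).trans (sub_eq_zero.mpr ?_)
    ring
  let e (x : ZMod 5) : A := MonoidAlgebra.of ℤ _ (Multiplicative.ofAdd x)
  have he (x y : ZMod 5) : e x * e y = e (x + y) := by simp only [e, ofAdd_add, map_mul]
  have he₀ : (1 : A) = e 0 := by simp only [e, ofAdd_zero, map_one]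
  let q := (LinearMap.range d₂).mkQ
  have hq (v) : q (d₂ v) = 0 := by simp [q]
  have hF : IsHSRelator fun x y z ↦ q (e x ⊗ₜ[ℤ] (e y ⊗ₜ[ℤ] e z)) :=
    { rel := fun a b c d ↦ by
        simpa only [h₂, he₀, he, map_add] using
          hq (e a ⊗ₜ[ℤ] (e b ⊗ₜ[ℤ] (e c ⊗ₜ[ℤ] e d)), 0)
      unit := fun a ↦ by simpa only [h₃, he₀] using hq (0, e a) }
  have : Fact (Nat.Prime 5) := ⟨Nat.prime_five⟩
  have hq₀ : q = 0 := by
    ext x y z : 9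
    exact hF.apply_eq_zero (by norm_num) x.toAdd y.toAdd z.toAdd
  rw [hker, LinearMap.ker_zero, ← (LinearMap.range d₂).ker_mkQ]
  exact (LinearMap.ker_eq_top.mpr hq₀).symm
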